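/- Let x ∈ ℝⁿ, let I be a set of indices such that for each i ∈ I one has x_i = 0 and β(x)_i ≠ 0, and define d ∈ ℝⁿ by d_i = −β(x)_i for i ∈ I and d_i = 0 for i ∉ I. Then for every real t with 0 ≤ t ≤ 1/L and every z ∈ ℝⁿ, F(x + t·d) ≤ F(z) + ⟨∇f(x) + λ·sgn(x + t·d), x − z⟩ − (t/2)·‖d‖², where sgn is applied componentwise, ⟨·,·⟩ is the Euclidean inner product, and ‖·‖ is the Euclidean norm. -/

import Mathlib

open Filter Finset

/-- sign function: 1 if positive, -1 if negative, 0 if zero. -/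
noncomputable def sgn (t : ℝ) : ℝ := if 0 < t then 1 else if t < 0 then -1 else 0

/-- the component of the optimality measure `β` for the zero variables,
given the regularization weight `lam`, the gradient component `gi` and the
variable component `xi`. -/
noncomputable def betaC (lam gi xi : ℝ) : ℝ :=
  if xi = 0 ∧ gi + lam < 0 then gi + lam
  else if xi = 0 ∧ 0 < gi - lam then gi - lam
  else 0

/-- the component of the optimality measure `φ` for the nonzero variables. -/
noncomputable def phiC (lam gi xi : ℝ) : ℝ :=
  if xi = 0 then 0
  else if 0 < xi ∧ 0 < gi + lam then min (gi + lam) (max xi (gi - lam))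
  else if xi < 0 ∧ gi - lam < 0 then max (gi - lam) (min xi (gi + lam))
  else gi + lam * sgn xi

/-- The derivative of a differentiable function along the line through `x` with direction `v`. -/
theorem hasDerivAt_comp_add_smul {E : Type*} [NormedAddCommGroup E] [InnerProductSpace ℝ E]
    [CompleteSpace E] {f : E → ℝ} (hf : Differentiable ℝ f) (x v : E) (s : ℝ) :
    HasDerivAt (fun s : ℝ => f (x + s • v)) (inner ℝ (gradient f (x + s • v)) v) s := by
  have h₁ : HasDerivAt (fun s : ℝ => x + s • v) v s := by
    simpa using ((hasDerivAt_id s).smul_const v).const_add x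
  simpa [Function.comp_def] using
    (hf (x + s • v)).hasGradientAt.hasFDerivAt.comp_hasDerivAt s h₁

/-- The descent lemma: quadratic upper bound for a function with `L`-Lipschitz gradient. -/
theorem le_add_inner_gradient_add_sq {E : Type*} [NormedAddCommGroup E] [InnerProductSpace ℝ E]
    [CompleteSpace E] {f : E → ℝ} (hf : Differentiable ℝ f) {L : ℝ}
    (hL : ∀ a b, ‖gradient f a - gradient f b‖ ≤ L * ‖a - b‖) (x v : E) :
    f (x + v) ≤ f x + inner ℝ (gradient f x) v + L / 2 * ‖v‖ ^ 2 := by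
  have hd (s : ℝ) : HasDerivAt
      (fun s : ℝ => f (x + s • v) - (s * inner ℝ (gradient f x) v + L / 2 * ‖v‖ ^ 2 * s ^ 2))
      (inner ℝ (gradient f (x + s • v)) v - (inner ℝ (gradient f x) v + L * ‖v‖ ^ 2 * s)) s := by
    refine ((hasDerivAt_comp_add_smul hf x v s).sub
      (((hasDerivAt_id s).mul_const (inner ℝ (gradient f x) v)).add
        ((hasDerivAt_pow 2 s).const_mul (L / 2 * ‖v‖ ^ 2)))).congr_deriv ?_
    push_cast
    ring
  have hanti : AntitoneOn
      (fun s : ℝ => f (x + s • v) - (s * inner ℝ (gradient f x) v + L / 2 * ‖v‖ ^ 2 * s ^ 2))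
      (Set.Ici 0) := by
    refine antitoneOn_of_deriv_nonpos (convex_Ici 0)
      (fun s _ => (hd s).continuousAt.continuousWithinAt)
      (fun s _ => (hd s).differentiableAt.differentiableWithinAt) fun s hs => ?_
    have hs : 0 < s := by simpa using hs
    rw [(hd s).deriv]
    have h₁ := real_inner_le_norm (gradient f (x + s • v) - gradient f x) v
    have h₂ := mul_le_mul_of_nonneg_right (hL (x + s • v) x) (norm_nonneg v)
    rw [add_sub_cancel_left, norm_smul, Real.norm_of_nonneg hs.le] at h₂
    rw [inner_sub_left] at h₁
    linarith
  have := hanti (Set.mem_Ici.2 le_rfl) (Set.mem_Ici.2 zero_le_one) zero_le_one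
  simp only [one_smul, zero_smul, add_zero] at this
  linarith

/-- The first-order characterization of convexity: a convex function lies above its tangents. -/
theorem ConvexOn.add_inner_gradient_le {E : Type*} [NormedAddCommGroup E] [InnerProductSpace ℝ E]
    [CompleteSpace E] {f : E → ℝ} (hc : ConvexOn ℝ Set.univ f) (hf : Differentiable ℝ f)
    (x v : E) : f x + inner ℝ (gradient f x) v ≤ f (x + v) := by
  have hline : ConvexOn ℝ Set.univ (fun s : ℝ => f (x + s • v)) := by
    have := hc.comp_affineMap (AffineMap.lineMap x (x + v))
    simpa [Function.comp_def, AffineMap.lineMap_apply, add_comm] using this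
  have hd : HasDerivAt (fun s : ℝ => f (x + s • v)) (inner ℝ (gradient f x) v) 0 := by
    simpa using hasDerivAt_comp_add_smul hf x v 0
  have := hline.le_slope_of_hasDerivAt (Set.mem_univ _) (Set.mem_univ _) zero_lt_one hd
  simp only [slope_def_field, one_smul, zero_smul, add_zero, sub_zero, div_one] at this
  linarith

theorem sgn_mul_le_abs (a b : ℝ) : sgn a * b ≤ |b| := by
  unfold sgn
  split_ifs
  · simpa using le_abs_self b
  · simpa using neg_le_abs b
  · simp

theorem sgn_mul_self (a : ℝ) : sgn a * a = |a| := by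
  unfold sgn
  split_ifs with h₁ h₂
  · rw [abs_of_pos h₁, one_mul]
  · rw [abs_of_neg h₂, neg_one_mul]
  · simp [le_antisymm (not_lt.1 h₁) (not_lt.1 h₂)]

/-- A step of length `t` along the negative nonzero `β`-component, starting from zero,
changes the linearized objective by exactly `-t β²`. -/
theorem mul_add_abs_betaC {lam g t : ℝ} (ht : 0 ≤ t) (hb : betaC lam g 0 ≠ 0) :
    g * (t * -betaC lam g 0) + lam * |t * -betaC lam g 0| = -t * betaC lam g 0 ^ 2 := by
  rw [abs_mul, abs_of_nonneg ht, abs_neg]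
  unfold betaC at *
  split_ifs at * with h₁ h₂
  · rw [abs_of_neg h₁.2]; ring
  · rw [abs_of_pos h₂.2]; ring
  · exact absurd rfl hb

/-- with `d` as the (negative) reduced `β`-step supported on `I`, for every
`0 ≤ t ≤ 1/L` and every `z`,
`F(x + t·d) ≤ F(z) + ⟨∇f(x) + λ·sgn(x + t·d), x - z⟩ - (t/2)·‖d‖²`. -/
theorem stmt6 (n : ℕ) (hn : 1 ≤ n)
    (f : EuclideanSpace ℝ (Fin n) → ℝ)
    (hconv : ConvexOn ℝ Set.univ f) (hdiff : Differentiable ℝ f)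
    (L : ℝ) (hL : 0 < L)
    (hLip : ∀ a b : EuclideanSpace ℝ (Fin n), ‖gradient f a - gradient f b‖ ≤ L * ‖a - b‖)
    (lam : ℝ) (hlam : 0 < lam)
    (F : EuclideanSpace ℝ (Fin n) → ℝ)
    (hF : ∀ y, F y = f y + lam * ∑ i, |y i|)
    (x : EuclideanSpace ℝ (Fin n)) (I : Set (Fin n))
    (hI : ∀ i ∈ I, x i = 0 ∧ betaC lam (gradient f x i) (x i) ≠ 0)
    (d : EuclideanSpace ℝ (Fin n))
    (hdI : ∀ i ∈ I, d i = -betaC lam (gradient f x i) (x i))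
    (hdO : ∀ i ∉ I, d i = 0) :
    ∀ t : ℝ, 0 ≤ t → t ≤ 1 / L → ∀ z : EuclideanSpace ℝ (Fin n),
      F (x + t • d) ≤
        F z + (∑ i, (gradient f x i + lam * sgn ((x + t • d) i)) * (x i - z i))
          - t / 2 * ‖d‖ ^ 2 := by
  intro t ht htL z
  have hdesc := le_add_inner_gradient_add_sq hdiff hLip x (t • d)
  have hconvex := hconv.add_inner_gradient_le hdiff x (z - x)
  rw [add_sub_cancel] at hconvex
  have hstep : L / 2 * ‖t • d‖ ^ 2 ≤ t / 2 * ‖d‖ ^ 2 := by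
    have htL' : t * L ≤ 1 := (le_div_iff₀ hL).1 htL
    rw [norm_smul, Real.norm_of_nonneg ht]
    nlinarith [mul_nonneg (mul_nonneg ht (sq_nonneg ‖d‖)) (sub_nonneg.2 htL')]
  have hcoord (i : Fin n) : gradient f x i * (t * d i) + lam * |x i + t * d i| ≤
      lam * |z i| + lam * sgn (x i + t * d i) * (x i - z i) - t * d i ^ 2 := by
    have hz := mul_le_mul_of_nonneg_left (sgn_mul_le_abs (x i + t * d i) (z i)) hlam.le
    by_cases hi : i ∈ I
    · obtain ⟨hx, hb⟩ := hI i hi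
      rw [hx] at hb
      have h := mul_add_abs_betaC ht hb
      have hdi := hdI i hi
      rw [hx] at hdi
      rw [hx, hdi, zero_add] at hz ⊢
      linarith
    · rw [hdO i hi, mul_zero, add_zero] at hz ⊢
      have := sgn_mul_self (x i)
      rw [← this]
      linarith
  have hsum := Finset.sum_le_sum fun i (_ : i ∈ Finset.univ) => hcoord i
  simp only [Finset.sum_add_distrib, Finset.sum_sub_distrib, ← Finset.mul_sum] at hsum
  have hinner (u v : EuclideanSpace ℝ (Fin n)) : inner ℝ u v = ∑ i, u i * v i := by
    simp [PiLp.inner_apply, mul_comm]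
  have hneg : inner ℝ (gradient f x) (z - x) = -∑ i, gradient f x i * (x i - z i) := by
    rw [hinner, ← Finset.sum_neg_distrib]
    exact Finset.sum_congr rfl fun i _ => by simp; ring
  rw [hneg] at hconvex
  rw [hinner] at hdesc
  rw [EuclideanSpace.real_norm_sq_eq d] at hstep ⊢
  simp only [hF, PiLp.add_apply, PiLp.smul_apply, smul_eq_mul, add_mul,
    Finset.sum_add_distrib] at hdesc ⊢
  linarith
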